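/- For every ε > 0 and integers 1 ≤ k ≤ n such that 2ε ≤ k/n and 2ε ≤ 1 − k/n, one has C(1 − k/n + ε) − 2e^{−2ε²n} ≤ C_{n,k} ≤ C(1 − k/n − ε) + 2e^{−2ε²n} + log₂(n+1)/n. -/

import Mathlib

open scoped BigOperators

noncomputable section

/-- Output alphabet of the binary deletion channel with `n` input bits:
a length `k ≤ n` together with a binary string of that length. -/
abbrev DelOut (n : ℕ) := Σ k : Fin (n + 1), (Fin (k : ℕ) → Bool)

/-- The subsequence of `x` indexed by `S` (taken in increasing order),
as an element of `DelOut n`. -/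
def restrictSub {n : ℕ} (x : Fin n → Bool) (S : Finset (Fin n)) : DelOut n :=
  ⟨⟨S.card, Nat.lt_succ_of_le (by simpa using Finset.card_le_univ S)⟩,
   fun i => x (S.orderEmbOfFin rfl i)⟩

/-- Transition probability of the binary deletion channel `W_n^d`: each input bit is
deleted independently with probability `d`. -/
def delW {n : ℕ} (d : ℝ) (x : Fin n → Bool) (y : DelOut n) : ℝ :=
  ∑ S : Finset (Fin n),
    if restrictSub x S = y then (1 - d) ^ S.card * d ^ (n - S.card) else 0

/-- Transition probability of the exact deletion channel `W_{n,k}`, which keeps exactly `k`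
of the `n` input bits, the kept positions being a uniformly random `k`-subset; `k`-subsets
are identified with strictly monotone maps `Fin k → Fin n`. -/
def exactW {n k : ℕ} (x : Fin n → Bool) (y : Fin k → Bool) : ℝ :=
  ((Finset.univ.filter fun f : Fin k → Fin n => StrictMono f ∧ x ∘ f = y).card : ℝ) /
    (n.choose k : ℝ)

/-- `p` is a probability distribution on the finite alphabet `α`. -/
def IsDist {α : Type*} [Fintype α] (p : α → ℝ) : Prop :=
  (∀ a, 0 ≤ p a) ∧ ∑ a, p a = 1

/-- Base-2 mutual information `I(X;Y)` between the input `X ~ p` and the output `Y`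
of the channel with transition matrix `W`. -/
def mutualInfo {α β : Type*} [Fintype α] [Fintype β] (p : α → ℝ) (W : α → β → ℝ) : ℝ :=
  ∑ x, ∑ y, p x * W x y * Real.logb 2 (W x y / ∑ x', p x' * W x' y)

/-- `C_n(d) = (1/n) · sup_p I(X ; W_n^d(X))`. -/
def Cn (n : ℕ) (d : ℝ) : ℝ :=
  (1 / (n : ℝ)) * ⨆ p : {p : (Fin n → Bool) → ℝ // IsDist p}, mutualInfo p.1 (delW d)

/-- `C_{n,k} = (1/n) · sup_p I(X ; W_{n,k}(X))`. -/
def Cnk (n k : ℕ) : ℝ :=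
  (1 / (n : ℝ)) * ⨆ p : {p : (Fin n → Bool) → ℝ // IsDist p},
    mutualInfo p.1 (exactW (n := n) (k := k))

/-- Capacity of the binary deletion channel: `C(d) = inf_{n ≥ 1} C_n(d)`. -/
def C (d : ℝ) : ℝ := ⨅ n : {m : ℕ // 1 ≤ m}, Cn n d

/-! ### Finite information theory -/

section InformationTheory

variable {α β γ ι : Type*}

/-- The log-sum inequality. -/
lemma sum_mul_logb_div_sum_le (s : Finset ι) (a b : ι → ℝ) (ha : ∀ i ∈ s, 0 ≤ a i)
    (hb : ∀ i ∈ s, 0 ≤ b i) (hab : ∀ i ∈ s, b i = 0 → a i = 0) :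
    (∑ i ∈ s, a i) * Real.logb 2 ((∑ i ∈ s, a i) / ∑ i ∈ s, b i) ≤
      ∑ i ∈ s, a i * Real.logb 2 (a i / b i) := by
  have hlog : (0 : ℝ) < Real.log 2 := Real.log_pos (by norm_num)
  set A := ∑ i ∈ s, a i with hA
  set B := ∑ i ∈ s, b i with hB
  rcases (Finset.sum_nonneg ha).eq_or_lt with h0 | hApos
  · have hz : ∀ i ∈ s, a i = 0 := (Finset.sum_eq_zero_iff_of_nonneg ha).1 h0.symm
    rw [Finset.sum_eq_zero fun i hi => by rw [hz i hi, zero_mul], hA, ← h0, zero_mul]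
  have hBpos : 0 < B := by
    refine (Finset.sum_nonneg hb).lt_of_ne fun h0 => hApos.ne' ?_
    have hz : ∀ i ∈ s, b i = 0 := (Finset.sum_eq_zero_iff_of_nonneg hb).1 h0.symm
    exact Finset.sum_eq_zero fun i hi => hab i hi (hz i hi)
  have key : ∀ i ∈ s, a i * Real.log (A / B) + (a i - b i * (A / B)) ≤
      a i * Real.log (a i / b i) := by
    intro i hi
    rcases (ha i hi).eq_or_lt with h0 | hai
    · rw [← h0]
      have := mul_nonneg (hb i hi) (div_nonneg hApos.le hBpos.le)
      linarith
    have hbi : 0 < b i := (hb i hi).lt_of_ne fun h => hai.ne' (hab i hi h.symm)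
    have hpos : 0 < a i / b i / (A / B) := by positivity
    have h1 := Real.one_sub_inv_le_log_of_pos hpos
    rw [Real.log_div (by positivity) (by positivity)] at h1
    have h2 := mul_le_mul_of_nonneg_left h1 hai.le
    have h3 : a i * (1 - (a i / b i / (A / B))⁻¹) = a i - b i * (A / B) := by
      field_simp
    linarith
  have hsum := Finset.sum_le_sum key
  rw [Finset.sum_add_distrib, Finset.sum_sub_distrib, ← Finset.sum_mul, ← Finset.sum_mul,
    ← hA, ← hB, mul_div_cancel₀ _ hBpos.ne', sub_self, add_zero] at hsum
  simp only [Real.logb, ← mul_div_assoc, ← Finset.sum_div]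
  gcongr

variable [Fintype α] [Fintype β] [Fintype γ]

/-- The law of the output of the channel `W` with input distribution `p`. -/
def outputLaw (p : α → ℝ) (W : α → β → ℝ) (y : β) : ℝ := ∑ x, p x * W x y

lemma outputLaw_nonneg {p : α → ℝ} {W : α → β → ℝ} (hp : IsDist p) (hW : ∀ x, IsDist (W x))
    (y : β) : 0 ≤ outputLaw p W y :=
  Finset.sum_nonneg fun x _ => mul_nonneg (hp.1 x) ((hW x).1 y)

lemma mul_le_outputLaw {p : α → ℝ} {W : α → β → ℝ} (hp : IsDist p) (hW : ∀ x, IsDist (W x))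
    (x : α) (y : β) : p x * W x y ≤ outputLaw p W y :=
  Finset.single_le_sum (f := fun x => p x * W x y)
    (fun x _ => mul_nonneg (hp.1 x) ((hW x).1 y)) (Finset.mem_univ x)

lemma outputLaw_pos {p : α → ℝ} {W : α → β → ℝ} (hp : IsDist p) (hW : ∀ x, IsDist (W x))
    {x : α} {y : β} (h : p x * W x y ≠ 0) : 0 < outputLaw p W y :=
  ((mul_nonneg (hp.1 x) ((hW x).1 y)).lt_of_ne h.symm).trans_le (mul_le_outputLaw hp hW x y)

lemma IsDist.outputLaw {p : α → ℝ} {W : α → β → ℝ} (hp : IsDist p) (hW : ∀ x, IsDist (W x)) :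
    IsDist (outputLaw p W) := by
  refine ⟨outputLaw_nonneg hp hW, ?_⟩
  simp only [_root_.outputLaw]
  rw [Finset.sum_comm]
  simp [← Finset.mul_sum, (hW _).2, hp.2]

lemma mutualInfo_eq (p : α → ℝ) (W : α → β → ℝ) :
    mutualInfo p W = ∑ x, ∑ y, p x * W x y * Real.logb 2 (W x y / outputLaw p W y) := rfl

lemma mutualInfo_nonneg {p : α → ℝ} {W : α → β → ℝ} (hp : IsDist p) (hW : ∀ x, IsDist (W x)) :
    0 ≤ mutualInfo p W := by
  have h := sum_mul_logb_div_sum_le (Finset.univ : Finset (α × β))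
    (fun z => p z.1 * W z.1 z.2) (fun z => p z.1 * outputLaw p W z.2)
    (fun z _ => mul_nonneg (hp.1 _) ((hW _).1 _))
    (fun z _ => mul_nonneg (hp.1 _) (outputLaw_nonneg hp hW _))
    (fun z _ h => by
      by_contra hne
      exact (mul_pos ((hp.1 _).lt_of_ne (left_ne_zero_of_mul hne).symm)
        (outputLaw_pos hp hW hne)).ne' h)
  simp only [Fintype.sum_prod_type, ← Finset.mul_sum, (hW _).2, (hp.outputLaw hW).2, hp.2,
    mul_one, mul_zero, div_one, Real.logb_one] at h
  refine h.trans_eq ?_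
  rw [mutualInfo_eq]
  refine Finset.sum_congr rfl fun x _ => Finset.sum_congr rfl fun y _ => ?_
  by_cases hx : p x = 0
  · simp [hx]
  · rw [mul_div_mul_left _ _ hx]

lemma mutualInfo_le_logb_card {p : α → ℝ} {W : α → β → ℝ} (hp : IsDist p)
    (hW : ∀ x, IsDist (W x)) : mutualInfo p W ≤ Real.logb 2 (Fintype.card α) := by
  have h := sum_mul_logb_div_sum_le (Finset.univ : Finset α) p (fun _ => 1)
    (fun x _ => hp.1 x) (fun _ _ => zero_le_one) (fun _ _ h => absurd h one_ne_zero)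
  simp only [hp.2, one_mul, div_one, Finset.sum_const, Finset.card_univ, nsmul_eq_mul, mul_one,
    one_div, Real.logb_inv] at h
  have hle : mutualInfo p W ≤ ∑ x, ∑ y, p x * W x y * -Real.logb 2 (p x) := by
    rw [mutualInfo_eq]
    refine Finset.sum_le_sum fun x _ => Finset.sum_le_sum fun y _ => ?_
    by_cases h0 : p x * W x y = 0
    · simp [h0]
    have hpx : 0 < p x := (hp.1 x).lt_of_ne (left_ne_zero_of_mul h0).symm
    have hWx : 0 < W x y := ((hW x).1 y).lt_of_ne (right_ne_zero_of_mul h0).symm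
    have hq := outputLaw_pos hp hW h0
    rw [← Real.logb_inv]
    refine mul_le_mul_of_nonneg_left ?_ (by positivity)
    refine Real.logb_le_logb_of_le (by norm_num) (by positivity) ?_
    rw [div_le_iff₀ hq, inv_mul_eq_div, le_div_iff₀ hpx, mul_comm]
    exact mul_le_outputLaw hp hW x y
  have heq : ∑ x, ∑ y, p x * W x y * -Real.logb 2 (p x) = -∑ x, p x * Real.logb 2 (p x) := by
    rw [← Finset.sum_neg_distrib]
    refine Finset.sum_congr rfl fun x _ => ?_
    rw [← Finset.sum_mul, ← Finset.mul_sum, (hW x).2]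
    ring
  linarith

/-- The composition of the channel `W` with the channel `V`. -/
def compChannel (W : α → β → ℝ) (V : β → γ → ℝ) (x : α) (z : γ) : ℝ := ∑ y, W x y * V y z

lemma isDist_compChannel {α : Type*} {W : α → β → ℝ} {V : β → γ → ℝ} (hW : ∀ x, IsDist (W x))
    (hV : ∀ y, IsDist (V y)) (x : α) : IsDist (compChannel W V x) :=
  (hW x).outputLaw hV

lemma outputLaw_compChannel {γ : Type*} (p : α → ℝ) (W : α → β → ℝ) (V : β → γ → ℝ) (z : γ) :
    outputLaw p (compChannel W V) z = ∑ y, outputLaw p W y * V y z := by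
  simp only [outputLaw, compChannel, Finset.mul_sum, Finset.sum_mul, ← mul_assoc]
  exact Finset.sum_comm

/-- The data processing inequality. -/
lemma mutualInfo_compChannel_le {p : α → ℝ} {W : α → β → ℝ} {V : β → γ → ℝ} (hp : IsDist p)
    (hW : ∀ x, IsDist (W x)) (hV : ∀ y, IsDist (V y)) :
    mutualInfo p (compChannel W V) ≤ mutualInfo p W := by
  have hterm : ∀ x z, p x * compChannel W V x z *
      Real.logb 2 (compChannel W V x z / outputLaw p (compChannel W V) z) ≤
      ∑ y, p x * W x y * Real.logb 2 (W x y / outputLaw p W y) * V y z := by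
    intro x z
    by_cases hx : p x = 0
    · simp [hx]
    have h := sum_mul_logb_div_sum_le (Finset.univ : Finset β)
      (fun y => W x y * V y z) (fun y => outputLaw p W y * V y z)
      (fun y _ => mul_nonneg ((hW x).1 y) ((hV y).1 z))
      (fun y _ => mul_nonneg (outputLaw_nonneg hp hW y) ((hV y).1 z))
      (fun y _ h => by
        by_contra hne
        exact mul_ne_zero (outputLaw_pos hp hW (mul_ne_zero hx (left_ne_zero_of_mul hne))).ne'
          (right_ne_zero_of_mul hne) h)
    rw [← outputLaw_compChannel] at h
    rw [mul_assoc]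
    refine (mul_le_mul_of_nonneg_left h (hp.1 x)).trans_eq ?_
    rw [Finset.mul_sum]
    refine Finset.sum_congr rfl fun y _ => ?_
    by_cases hv : V y z = 0
    · simp [hv]
    · rw [mul_div_mul_right _ _ hv]
      ring
  rw [mutualInfo_eq, mutualInfo_eq]
  refine Finset.sum_le_sum fun x _ => (Finset.sum_le_sum fun z _ => hterm x z).trans_eq ?_
  rw [Finset.sum_comm]
  simp [← Finset.mul_sum, (hV _).2]

/-- The deterministic channel given by a function. -/
def mapChannel [DecidableEq γ] (f : β → γ) (y : β) (z : γ) : ℝ := if f y = z then 1 else 0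

lemma isDist_mapChannel {β : Type*} [DecidableEq γ] (f : β → γ) (y : β) : IsDist (mapChannel f y) :=
  ⟨fun z => by unfold mapChannel; split_ifs <;> simp, by simp [mapChannel]⟩

/-- Applying a function with fibres of size at most `M` to the output of a channel costs at most
`log₂ M` bits of mutual information. -/
lemma mutualInfo_le_compChannel_mapChannel_add [DecidableEq γ] {p : α → ℝ} {W : α → β → ℝ}
    (hp : IsDist p) (hW : ∀ x, IsDist (W x)) (f : β → γ) (M : ℕ)
    (hM : ∀ z, (Finset.univ.filter fun y => f y = z).card ≤ M) :
    mutualInfo p W ≤ mutualInfo p (compChannel W (mapChannel f)) + Real.logb 2 M := by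
  set V := mapChannel f
  have hV : ∀ y, IsDist (V y) := isDist_mapChannel f
  have hWV := isDist_compChannel hW hV
  set Q := outputLaw p (compChannel W V)
  have hVsum : ∀ (y : β) (g : γ → ℝ), ∑ z, V y z * g z = g (f y) := by
    intro y g
    simp [V, mapChannel]
  have hWle : ∀ x y, W x y ≤ compChannel W V x (f y) := by
    intro x y
    refine le_trans ?_ (Finset.single_le_sum (f := fun y' => W x y' * V y' (f y))
      (fun y' _ => mul_nonneg ((hW x).1 y') ((hV y').1 _)) (Finset.mem_univ y))
    simp [V, mapChannel]
  have hqle : ∀ y, outputLaw p W y ≤ Q (f y) := fun y =>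
    Finset.sum_le_sum fun x _ => mul_le_mul_of_nonneg_left (hWle x y) (hp.1 x)
  have hmap : mutualInfo p (compChannel W V) =
      ∑ x, ∑ y, p x * W x y * Real.logb 2 (compChannel W V x (f y) / Q (f y)) := by
    rw [mutualInfo_eq]
    refine Finset.sum_congr rfl fun x _ => ?_
    have : ∀ z, p x * compChannel W V x z * Real.logb 2 (compChannel W V x z / Q z) =
        ∑ y, p x * W x y * (V y z * Real.logb 2 (compChannel W V x z / Q z)) := by
      intro z
      conv_lhs => rw [compChannel.eq_1 W V x z, Finset.mul_sum, Finset.sum_mul]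
      refine Finset.sum_congr rfl fun y _ => ?_
      rw [compChannel.eq_1 W V x z]
      ring
    rw [Finset.sum_congr rfl fun z _ => this z, Finset.sum_comm]
    refine Finset.sum_congr rfl fun y _ => ?_
    rw [← Finset.mul_sum, hVsum y fun z => Real.logb 2 (compChannel W V x z / Q z)]
  have hdiff : mutualInfo p W ≤ mutualInfo p (compChannel W V) +
      ∑ x, ∑ y, p x * W x y * -Real.logb 2 (outputLaw p W y / Q (f y)) := by
    rw [hmap, mutualInfo_eq, ← Finset.sum_add_distrib]
    refine Finset.sum_le_sum fun x _ => ?_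
    rw [← Finset.sum_add_distrib]
    refine Finset.sum_le_sum fun y _ => ?_
    by_cases h0 : p x * W x y = 0
    · simp [h0]
    have hpx : 0 < p x := (hp.1 x).lt_of_ne (left_ne_zero_of_mul h0).symm
    have hWx : 0 < W x y := ((hW x).1 y).lt_of_ne (right_ne_zero_of_mul h0).symm
    have hq := outputLaw_pos hp hW h0
    have hQ : 0 < Q (f y) := hq.trans_le (hqle y)
    have hWf : 0 < compChannel W V x (f y) := hWx.trans_le (hWle x y)
    rw [← mul_add]
    refine mul_le_mul_of_nonneg_left ?_ (by positivity)
    rw [Real.logb_div hWx.ne' hq.ne', Real.logb_div hWf.ne' hQ.ne',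
      Real.logb_div hq.ne' hQ.ne']
    have := Real.logb_le_logb_of_le one_lt_two hWx (hWle x y)
    linarith
  have hent := sum_mul_logb_div_sum_le (Finset.univ : Finset β) (outputLaw p W)
    (fun y => Q (f y)) (fun y _ => outputLaw_nonneg hp hW y)
    (fun y _ => outputLaw_nonneg hp hWV _)
    (fun y _ h => le_antisymm ((hqle y).trans_eq h) (outputLaw_nonneg hp hW y))
  have hB : ∑ y, Q (f y) ≤ M := by
    calc ∑ y, Q (f y) = ∑ z, ∑ y, V y z * Q z := by
          rw [Finset.sum_comm]
          exact Finset.sum_congr rfl fun y _ => (hVsum y Q).symm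
      _ ≤ ∑ z, M * Q z := by
          refine Finset.sum_le_sum fun z _ => ?_
          rw [← Finset.sum_mul]
          refine mul_le_mul_of_nonneg_right ?_ (outputLaw_nonneg hp hWV z)
          simpa [V, mapChannel] using hM z
      _ = M := by rw [← Finset.mul_sum, (hp.outputLaw hWV).2, mul_one]
  have hB1 : 1 ≤ ∑ y, Q (f y) := by
    rw [← (hp.outputLaw hW).2]
    exact Finset.sum_le_sum fun y _ => hqle y
  have hlogB := Real.logb_le_logb_of_le one_lt_two (zero_lt_one.trans_le hB1) hB
  rw [(hp.outputLaw hW).2, one_mul, one_div, Real.logb_inv] at hent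
  have hsum : ∑ x, ∑ y, p x * W x y * -Real.logb 2 (outputLaw p W y / Q (f y)) =
      -∑ y, outputLaw p W y * Real.logb 2 (outputLaw p W y / Q (f y)) := by
    rw [Finset.sum_comm, ← Finset.sum_neg_distrib]
    refine Finset.sum_congr rfl fun y _ => ?_
    rw [← Finset.sum_mul, mul_neg]
    rfl
  linarith

/-- Mutual information is invariant under relabelling of the input alphabet. -/
lemma mutualInfo_comp_equiv {α' : Type*} [Fintype α'] (e : α' ≃ α) (p : α → ℝ)
    (W : α → β → ℝ) : mutualInfo (p ∘ e) (W ∘ e) = mutualInfo p W := by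
  simp only [mutualInfo, Function.comp_apply]
  rw [← Equiv.sum_comp e]
  refine Finset.sum_congr rfl fun x _ => Finset.sum_congr rfl fun y _ => ?_
  rw [Equiv.sum_comp e fun x => p x * W x y]

lemma IsDist.comp_equiv {α' : Type*} [Fintype α'] {p : α → ℝ} (hp : IsDist p) (e : α' ≃ α) :
    IsDist (p ∘ e) :=
  ⟨fun a => hp.1 (e a), by simpa using (Equiv.sum_comp e p).trans hp.2⟩

section Product

variable {α₁ α₂ β₁ β₂ : Type*} [Fintype α₁] [Fintype α₂] [Fintype β₁] [Fintype β₂]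

/-- The product of two channels, used independently. -/
def prodChannel (W₁ : α₁ → β₁ → ℝ) (W₂ : α₂ → β₂ → ℝ) (x : α₁ × α₂) (y : β₁ × β₂) : ℝ :=
  W₁ x.1 y.1 * W₂ x.2 y.2

lemma IsDist.prod {p₁ : α₁ → ℝ} {p₂ : α₂ → ℝ} (h₁ : IsDist p₁) (h₂ : IsDist p₂) :
    IsDist fun x : α₁ × α₂ => p₁ x.1 * p₂ x.2 :=
  ⟨fun x => mul_nonneg (h₁.1 _) (h₂.1 _), by
    simp [Fintype.sum_prod_type, ← Finset.mul_sum, h₁.2, h₂.2]⟩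

lemma isDist_prodChannel {α₁ α₂ : Type*} {W₁ : α₁ → β₁ → ℝ} {W₂ : α₂ → β₂ → ℝ}
    (h₁ : ∀ x, IsDist (W₁ x)) (h₂ : ∀ x, IsDist (W₂ x)) (x : α₁ × α₂) :
    IsDist (prodChannel W₁ W₂ x) :=
  (h₁ x.1).prod (h₂ x.2)

lemma isDist_marginal_fst {p : α₁ × α₂ → ℝ} (hp : IsDist p) :
    IsDist fun x₁ => ∑ x₂, p (x₁, x₂) :=
  ⟨fun _ => Finset.sum_nonneg fun _ _ => hp.1 _, by rw [← Fintype.sum_prod_type]; exact hp.2⟩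

lemma isDist_marginal_snd {p : α₁ × α₂ → ℝ} (hp : IsDist p) :
    IsDist fun x₂ => ∑ x₁, p (x₁, x₂) :=
  ⟨fun _ => Finset.sum_nonneg fun _ _ => hp.1 _, by
    rw [← Fintype.sum_prod_type_right]; exact hp.2⟩

/-- The chain rule for a product channel: the defect of additivity is the divergence of the
output law from the product of its marginals. -/
lemma mutualInfo_prodChannel_add {p : α₁ × α₂ → ℝ} {W₁ : α₁ → β₁ → ℝ} {W₂ : α₂ → β₂ → ℝ}
    (hp : IsDist p) (h₁ : ∀ x, IsDist (W₁ x)) (h₂ : ∀ x, IsDist (W₂ x)) :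
    mutualInfo p (prodChannel W₁ W₂) + ∑ y : β₁ × β₂, outputLaw p (prodChannel W₁ W₂) y *
        Real.logb 2 (outputLaw p (prodChannel W₁ W₂) y /
          (outputLaw (fun x₁ => ∑ x₂, p (x₁, x₂)) W₁ y.1 *
            outputLaw (fun x₂ => ∑ x₁, p (x₁, x₂)) W₂ y.2)) =
      mutualInfo (fun x₁ => ∑ x₂, p (x₁, x₂)) W₁ +
        mutualInfo (fun x₂ => ∑ x₁, p (x₁, x₂)) W₂ := by
  set p₁ := fun x₁ => ∑ x₂, p (x₁, x₂)
  set p₂ := fun x₂ => ∑ x₁, p (x₁, x₂)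
  have hp₁ : IsDist p₁ := isDist_marginal_fst hp
  have hp₂ : IsDist p₂ := isDist_marginal_snd hp
  have hW := isDist_prodChannel h₁ h₂
  have e₁ : mutualInfo p₁ W₁ = ∑ x, ∑ y, p x * prodChannel W₁ W₂ x y *
      Real.logb 2 (W₁ x.1 y.1 / outputLaw p₁ W₁ y.1) := by
    simp only [mutualInfo_eq, Fintype.sum_prod_type, prodChannel]
    refine Finset.sum_congr rfl fun x₁ _ => ?_
    rw [Finset.sum_comm]
    refine Finset.sum_congr rfl fun y₁ _ => ?_
    simp only [← Finset.sum_mul, ← Finset.mul_sum, (h₂ _).2, mul_one, p₁]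
  have e₂ : mutualInfo p₂ W₂ = ∑ x, ∑ y, p x * prodChannel W₁ W₂ x y *
      Real.logb 2 (W₂ x.2 y.2 / outputLaw p₂ W₂ y.2) := by
    simp only [mutualInfo_eq, Fintype.sum_prod_type_right, prodChannel]
    refine Finset.sum_congr rfl fun x₂ _ => ?_
    rw [Finset.sum_comm]
    refine Finset.sum_congr rfl fun y₂ _ => ?_
    simp only [← Finset.sum_mul, ← Finset.mul_sum, (h₁ _).2, one_mul, p₂]
  rw [e₁, e₂, mutualInfo_eq]
  conv_lhs =>
    arg 2
    arg 2
    intro y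
    arg 1
    unfold outputLaw
  simp only [Finset.sum_mul]
  rw [Finset.sum_comm (s := (Finset.univ : Finset (β₁ × β₂)))]
  simp only [← Finset.sum_add_distrib]
  refine Finset.sum_congr rfl fun x _ => Finset.sum_congr rfl fun y _ => ?_
  by_cases h0 : p x * prodChannel W₁ W₂ x y = 0
  · simp [h0]
  have hq := outputLaw_pos hp hW h0
  have hw₁ : W₁ x.1 y.1 ≠ 0 := left_ne_zero_of_mul (right_ne_zero_of_mul h0)
  have hw₂ : W₂ x.2 y.2 ≠ 0 := right_ne_zero_of_mul (right_ne_zero_of_mul h0)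
  have hpx : 0 < p x := (hp.1 x).lt_of_ne (left_ne_zero_of_mul h0).symm
  have hx₁ : p₁ x.1 ≠ 0 := (hpx.trans_le (Finset.single_le_sum (f := fun x₂ => p (x.1, x₂))
    (fun _ _ => hp.1 _) (Finset.mem_univ x.2))).ne'
  have hx₂ : p₂ x.2 ≠ 0 := (hpx.trans_le (Finset.single_le_sum (f := fun x₁ => p (x₁, x.2))
    (fun _ _ => hp.1 _) (Finset.mem_univ x.1))).ne'
  have hq₁ := outputLaw_pos hp₁ h₁ (mul_ne_zero hx₁ hw₁)
  have hq₂ := outputLaw_pos hp₂ h₂ (mul_ne_zero hx₂ hw₂)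
  rw [← mul_add, ← mul_add, prodChannel, Real.logb_div (mul_ne_zero hw₁ hw₂) hq.ne',
    Real.logb_div hq.ne' (mul_pos hq₁ hq₂).ne', Real.logb_div hw₁ hq₁.ne',
    Real.logb_div hw₂ hq₂.ne', Real.logb_mul hw₁ hw₂, Real.logb_mul hq₁.ne' hq₂.ne']
  ring

lemma mutualInfo_prodChannel_le {p : α₁ × α₂ → ℝ} {W₁ : α₁ → β₁ → ℝ} {W₂ : α₂ → β₂ → ℝ}
    (hp : IsDist p) (h₁ : ∀ x, IsDist (W₁ x)) (h₂ : ∀ x, IsDist (W₂ x)) :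
    mutualInfo p (prodChannel W₁ W₂) ≤ mutualInfo (fun x₁ => ∑ x₂, p (x₁, x₂)) W₁ +
      mutualInfo (fun x₂ => ∑ x₁, p (x₁, x₂)) W₂ := by
  have hp₁ := isDist_marginal_fst hp
  have hp₂ := isDist_marginal_snd hp
  have hW := isDist_prodChannel h₁ h₂
  rw [← mutualInfo_prodChannel_add hp h₁ h₂, le_add_iff_nonneg_right]
  have hq₁ := hp₁.outputLaw h₁
  have hq₂ := hp₂.outputLaw h₂
  refine le_trans ?_ (sum_mul_logb_div_sum_le Finset.univ _ _
    (fun y _ => outputLaw_nonneg hp hW y) (fun y _ => (hq₁.prod hq₂).1 y) ?_)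
  · rw [(hp.outputLaw hW).2, (hq₁.prod hq₂).2]
    simp
  · intro y _ hy
    refine Finset.sum_eq_zero fun x _ => ?_
    by_contra h0
    have hw₁ : W₁ x.1 y.1 ≠ 0 := left_ne_zero_of_mul (right_ne_zero_of_mul h0)
    have hw₂ : W₂ x.2 y.2 ≠ 0 := right_ne_zero_of_mul (right_ne_zero_of_mul h0)
    have hpx : 0 < p x := (hp.1 x).lt_of_ne (left_ne_zero_of_mul h0).symm
    have hx₁ := (hpx.trans_le (Finset.single_le_sum (f := fun x₂ => p (x.1, x₂))
      (fun _ _ => hp.1 _) (Finset.mem_univ x.2))).ne'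
    have hx₂ := (hpx.trans_le (Finset.single_le_sum (f := fun x₁ => p (x₁, x.2))
      (fun _ _ => hp.1 _) (Finset.mem_univ x.1))).ne'
    exact (mul_pos (outputLaw_pos hp₁ h₁ (mul_ne_zero hx₁ hw₁))
      (outputLaw_pos hp₂ h₂ (mul_ne_zero hx₂ hw₂))).ne' hy

lemma mutualInfo_prodChannel_of_indep {p₁ : α₁ → ℝ} {p₂ : α₂ → ℝ} {W₁ : α₁ → β₁ → ℝ}
    {W₂ : α₂ → β₂ → ℝ} (hp₁ : IsDist p₁) (hp₂ : IsDist p₂) (h₁ : ∀ x, IsDist (W₁ x))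
    (h₂ : ∀ x, IsDist (W₂ x)) :
    mutualInfo (fun x : α₁ × α₂ => p₁ x.1 * p₂ x.2) (prodChannel W₁ W₂) =
      mutualInfo p₁ W₁ + mutualInfo p₂ W₂ := by
  have h := mutualInfo_prodChannel_add (hp₁.prod hp₂) h₁ h₂
  have e₁ : (fun x₁ => ∑ x₂, p₁ x₁ * p₂ x₂) = p₁ := by
    funext x
    rw [← Finset.mul_sum, hp₂.2, mul_one]
  have e₂ : (fun x₂ => ∑ x₁, p₁ x₁ * p₂ x₂) = p₂ := by
    funext x
    rw [← Finset.sum_mul, hp₁.2, one_mul]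
  rw [e₁, e₂] at h
  rw [← h, left_eq_add]
  refine Finset.sum_eq_zero fun y _ => ?_
  have hq : outputLaw (fun x : α₁ × α₂ => p₁ x.1 * p₂ x.2) (prodChannel W₁ W₂) y =
      outputLaw p₁ W₁ y.1 * outputLaw p₂ W₂ y.2 := by
    simp only [outputLaw, prodChannel, Fintype.sum_prod_type, Finset.sum_mul_sum]
    refine Finset.sum_congr rfl fun _ _ => Finset.sum_congr rfl fun _ _ => ?_
    ring
  rw [hq]
  by_cases h0 : outputLaw p₁ W₁ y.1 * outputLaw p₂ W₂ y.2 = 0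
  · simp [h0]
  · simp [div_self h0]

end Product

end InformationTheory

/-! ### Combinatorics of the two deletion channels -/

section Combinatorics

variable {n k l : ℕ}

lemma restrictSub_eq_mk (x : Fin n → Bool) (S : Finset (Fin n)) (h : S.card = l)
    (hl : l < n + 1) : restrictSub x S = ⟨⟨l, hl⟩, x ∘ S.orderEmbOfFin h⟩ := by
  subst h
  rfl

lemma card_image_of_strictMono {f : Fin l → Fin n} (hf : StrictMono f) :
    (Finset.univ.image f).card = l := by
  rw [Finset.card_image_of_injective _ hf.injective, Finset.card_fin]

lemma orderEmbOfFin_image {f : Fin l → Fin n} (hf : StrictMono f) :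
    ⇑((Finset.univ.image f).orderEmbOfFin (card_image_of_strictMono hf)) = f :=
  (Finset.orderEmbOfFin_unique _ (fun i => Finset.mem_image_of_mem f (Finset.mem_univ i)) hf).symm

lemma strictMono_eq_of_image_eq {f g : Fin l → Fin n} (hf : StrictMono f) (hg : StrictMono g)
    (h : Finset.univ.image f = Finset.univ.image g) : f = g := by
  rw [← orderEmbOfFin_image hf, ← orderEmbOfFin_image hg]
  simp only [h]

/-- Strictly monotone maps `Fin l → Fin n` correspond to `l`-element subsets. -/
lemma card_filter_strictMono (P : (Fin l → Fin n) → Prop) (Q : Finset (Fin n) → Prop)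
    [DecidablePred P] [DecidablePred Q]
    (hPQ : ∀ f, StrictMono f → (P f ↔ Q (Finset.univ.image f))) :
    (Finset.univ.filter fun f : Fin l → Fin n => StrictMono f ∧ P f).card =
      (Finset.univ.filter fun S : Finset (Fin n) => S.card = l ∧ Q S).card := by
  refine Finset.card_bij (fun f _ => Finset.univ.image f) ?_ ?_ ?_
  · intro f hf
    simp only [Finset.mem_filter, Finset.mem_univ, true_and] at hf ⊢
    exact ⟨card_image_of_strictMono hf.1, (hPQ f hf.1).1 hf.2⟩
  · intro f hf g hg h
    simp only [Finset.mem_filter, Finset.mem_univ, true_and] at hf hg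
    exact strictMono_eq_of_image_eq hf.1 hg.1 h
  · intro S hS
    simp only [Finset.mem_filter, Finset.mem_univ, true_and] at hS
    have hmono := (S.orderEmbOfFin hS.1).strictMono
    have himg := Finset.image_orderEmbOfFin_univ S hS.1
    refine ⟨S.orderEmbOfFin hS.1, ?_, himg⟩
    simp only [Finset.mem_filter, Finset.mem_univ, true_and]
    exact ⟨hmono, (hPQ _ hmono).2 (himg.symm ▸ hS.2)⟩

lemma card_strictMono_fin :
    (Finset.univ.filter fun f : Fin l → Fin n => StrictMono f).card = n.choose l := by
  have h := card_filter_strictMono (l := l) (n := n) (fun _ => True) (fun _ => True)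
    (fun _ _ => Iff.rfl)
  simp only [and_true] at h
  rw [h, Finset.univ_filter_card_eq, Finset.card_powersetCard, Finset.card_fin]

lemma delW_eq_mul_exactW (d : ℝ) (x : Fin n → Bool) (l : Fin (n + 1)) (y : Fin (l : ℕ) → Bool) :
    delW d x ⟨l, y⟩ = ((1 - d) ^ (l : ℕ) * d ^ (n - l) * n.choose l) * exactW x y := by
  obtain ⟨l, hl⟩ := l
  have hcard : (Finset.univ.filter fun S : Finset (Fin n) =>
      restrictSub x S = ⟨⟨l, hl⟩, y⟩).card =
      (Finset.univ.filter fun f : Fin l → Fin n => StrictMono f ∧ x ∘ f = y).card := by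
    rw [card_filter_strictMono (fun f => x ∘ f = y)
      (fun S => restrictSub x S = ⟨⟨l, hl⟩, y⟩)]
    · congr 1
      ext S
      simp only [Finset.mem_filter, Finset.mem_univ, true_and]
      refine ⟨fun h => ⟨?_, h⟩, fun h => h.2⟩
      exact congrArg (fun z : DelOut n => (z.1 : ℕ)) h
    · intro f hf
      rw [restrictSub_eq_mk x _ (card_image_of_strictMono hf) hl, orderEmbOfFin_image hf]
      simp
  have hterm : ∀ S : Finset (Fin n), (if restrictSub x S = ⟨⟨l, hl⟩, y⟩ then
      (1 - d) ^ S.card * d ^ (n - S.card) else 0) =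
      if restrictSub x S = ⟨⟨l, hl⟩, y⟩ then (1 - d) ^ l * d ^ (n - l) else 0 := by
    intro S
    refine if_ctx_congr Iff.rfl (fun h => ?_) fun _ => rfl
    have : S.card = l := congrArg (fun z : DelOut n => (z.1 : ℕ)) h
    rw [this]
  have hne : (n.choose l : ℝ) ≠ 0 := by
    exact_mod_cast (Nat.choose_pos (Nat.lt_succ_iff.1 hl)).ne'
  rw [delW, Finset.sum_congr rfl fun S _ => hterm S, ← Finset.sum_filter, Finset.sum_const, hcard,
    exactW, nsmul_eq_mul]
  field_simp

lemma isDist_exactW (hkn : k ≤ n) (x : Fin n → Bool) : IsDist (exactW (k := k) x) := by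
  refine ⟨fun y => by unfold exactW; positivity, ?_⟩
  have hne : (n.choose k : ℝ) ≠ 0 := by exact_mod_cast (Nat.choose_pos hkn).ne'
  simp only [exactW]
  rw [← Finset.sum_div, div_eq_one_iff_eq hne, ← card_strictMono_fin,
    Finset.card_eq_sum_card_fiberwise (f := fun f => x ∘ f) (t := Finset.univ)
      (fun _ _ => Finset.mem_coe.2 (Finset.mem_univ _))]
  push_cast
  simp only [Finset.filter_filter]

lemma isDist_delW {d : ℝ} (h0 : 0 ≤ d) (h1 : d ≤ 1) (x : Fin n → Bool) : IsDist (delW d x) := by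
  have h1' : 0 ≤ 1 - d := by linarith
  refine ⟨fun y => Finset.sum_nonneg fun S _ => by split_ifs <;> positivity, ?_⟩
  simp only [delW]
  rw [Finset.sum_comm]
  simp only [Finset.sum_ite_eq, Finset.mem_univ, if_true]
  rw [Fin.sum_pow_mul_eq_add_pow]
  simp

lemma card_supersets (hlk : l ≤ k) (T : Finset (Fin n)) (hT : T.card = l) :
    (Finset.univ.filter fun S : Finset (Fin n) => S.card = k ∧ T ⊆ S).card =
      (n - l).choose (k - l) := by
  have hc : (Tᶜ).card = n - l := by rw [Finset.card_compl, hT, Fintype.card_fin]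
  rw [← hc, ← Finset.card_powersetCard]
  refine Finset.card_nbij' (fun S => S \ T) (fun R => R ∪ T) ?_ ?_ ?_ ?_
  · intro S hS
    simp only [Finset.coe_filter, Finset.mem_univ, true_and, Set.mem_ofPred_eq] at hS
    simp only [Finset.mem_coe, Finset.mem_powersetCard]
    refine ⟨fun a ha => ?_, ?_⟩
    · simpa using (Finset.mem_sdiff.1 ha).2
    · rw [Finset.card_sdiff_of_subset hS.2, hS.1, hT]
  · intro R hR
    simp only [Finset.mem_coe, Finset.mem_powersetCard] at hR
    simp only [Finset.coe_filter, Finset.mem_univ, true_and, Set.mem_ofPred_eq]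
    refine ⟨?_, Finset.subset_union_right⟩
    rw [Finset.card_union_of_disjoint (Finset.disjoint_left.2 fun a ha =>
      Finset.mem_compl.1 (hR.1 ha)), hR.2, hT]
    omega
  · intro S hS
    simp only [Finset.coe_filter, Finset.mem_univ, true_and, Set.mem_ofPred_eq] at hS
    exact Finset.sdiff_union_of_subset hS.2
  · intro R hR
    simp only [Finset.mem_coe, Finset.mem_powersetCard] at hR
    exact Finset.union_sdiff_cancel_right (Finset.disjoint_left.2 fun a ha =>
      Finset.mem_compl.1 (hR.1 ha))

lemma card_factorizations (hlk : l ≤ k) {h : Fin l → Fin n} (hh : StrictMono h) :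
    (Finset.univ.filter fun fg : (Fin k → Fin n) × (Fin l → Fin k) =>
      (StrictMono fg.1 ∧ StrictMono fg.2) ∧ fg.1 ∘ fg.2 = h).card = (n - l).choose (k - l) := by
  have hsup := card_supersets hlk (Finset.univ.image h) (card_image_of_strictMono hh)
  rw [← hsup, ← card_filter_strictMono (fun f => Finset.univ.image h ⊆ Finset.univ.image f) _
    fun f _ => Iff.rfl]
  refine Finset.card_bij (fun fg _ => fg.1) ?_ ?_ ?_
  · rintro ⟨f, g⟩ hfg
    simp only [Finset.mem_filter, Finset.mem_univ, true_and] at hfg ⊢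
    refine ⟨hfg.1.1, ?_⟩
    rw [← hfg.2, ← Finset.image_image]
    exact Finset.image_subset_image (Finset.subset_univ _)
  · rintro ⟨f, g⟩ hfg ⟨f', g'⟩ hfg' (rfl : f = f')
    simp only [Finset.mem_filter, Finset.mem_univ, true_and] at hfg hfg'
    rw [hfg.1.1.injective.comp_left (hfg.2.trans hfg'.2.symm)]
  · intro f hf
    simp only [Finset.mem_filter, Finset.mem_univ, true_and] at hf
    have hex : ∀ i, ∃ j, f j = h i := fun i => by
      simpa using hf.2 (Finset.mem_image_of_mem h (Finset.mem_univ i))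
    choose g hg using hex
    refine ⟨(f, g), ?_, rfl⟩
    simp only [Finset.mem_filter, Finset.mem_univ, true_and]
    refine ⟨⟨hf.1, fun i j hij => ?_⟩, funext hg⟩
    rw [← hf.1.lt_iff_lt, hg, hg]
    exact hh hij

/-- Keeping `k` of `n` bits and then `l` of those `k` bits amounts to keeping `l` of `n` bits. -/
lemma compChannel_exactW (hlk : l ≤ k) (hkn : k ≤ n) :
    compChannel (exactW (n := n) (k := k)) (exactW (n := k) (k := l)) =
      exactW (n := n) (k := l) := by
  funext x z
  set T := Finset.univ.filter fun fg : (Fin k → Fin n) × (Fin l → Fin k) =>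
    (StrictMono fg.1 ∧ StrictMono fg.2) ∧ x ∘ fg.1 ∘ fg.2 = z with hT
  have hTy : T.card = ∑ y : Fin k → Bool,
      (Finset.univ.filter fun f : Fin k → Fin n => StrictMono f ∧ x ∘ f = y).card *
      (Finset.univ.filter fun g : Fin l → Fin k => StrictMono g ∧ y ∘ g = z).card := by
    rw [Finset.card_eq_sum_card_fiberwise (f := fun fg => x ∘ fg.1) (t := Finset.univ)
      (fun _ _ => Finset.mem_coe.2 (Finset.mem_univ _))]
    refine Finset.sum_congr rfl fun y _ => ?_
    rw [← Finset.card_product]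
    congr 1
    ext ⟨f, g⟩
    simp only [hT, Finset.mem_filter, Finset.mem_univ, true_and, Finset.mem_product]
    constructor
    · rintro ⟨⟨⟨hf, hg⟩, hz⟩, rfl⟩
      exact ⟨⟨hf, rfl⟩, hg, hz⟩
    · rintro ⟨⟨hf, rfl⟩, hg, hz⟩
      exact ⟨⟨⟨hf, hg⟩, hz⟩, rfl⟩
  have hTh : T.card =
      (Finset.univ.filter fun h : Fin l → Fin n => StrictMono h ∧ x ∘ h = z).card *
        (n - l).choose (k - l) := by
    rw [Finset.card_eq_sum_card_fiberwise (f := fun fg => fg.1 ∘ fg.2)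
      (t := Finset.univ.filter fun h : Fin l → Fin n => StrictMono h ∧ x ∘ h = z)]
    · rw [← smul_eq_mul, ← Finset.sum_const]
      refine Finset.sum_congr rfl fun h hh => ?_
      simp only [Finset.mem_filter, Finset.mem_univ, true_and] at hh
      rw [← card_factorizations hlk hh.1]
      congr 1
      ext ⟨f, g⟩
      simp only [hT, Finset.mem_filter, Finset.mem_univ, true_and]
      constructor
      · rintro ⟨⟨hfg, -⟩, he⟩
        exact ⟨hfg, he⟩
      · rintro ⟨hfg, he⟩
        exact ⟨⟨hfg, he ▸ hh.2⟩, he⟩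
    · rintro ⟨f, g⟩ hfg
      simp only [hT, Finset.coe_filter, Finset.mem_univ, true_and, Set.mem_ofPred_eq] at hfg ⊢
      exact ⟨hfg.1.1.comp hfg.1.2, hfg.2⟩
  have hchoose : (n.choose k : ℝ) * k.choose l = n.choose l * (n - l).choose (k - l) := by
    exact_mod_cast Nat.choose_mul hlk
  have hnk : (n.choose k : ℝ) ≠ 0 := by exact_mod_cast (Nat.choose_pos hkn).ne'
  have hkl : (k.choose l : ℝ) ≠ 0 := by exact_mod_cast (Nat.choose_pos hlk).ne'
  have hnl : (n.choose l : ℝ) ≠ 0 := by exact_mod_cast (Nat.choose_pos (hlk.trans hkn)).ne'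
  have hcount := hTy.symm.trans hTh
  simp only [compChannel, exactW, div_mul_div_comm]
  rw [← Finset.sum_div, div_eq_div_iff (mul_ne_zero hnk hkl) hnl, hchoose]
  rw [show (∑ y : Fin k → Bool,
      ((Finset.univ.filter fun f : Fin k → Fin n => StrictMono f ∧ x ∘ f = y).card : ℝ) *
      ((Finset.univ.filter fun g : Fin l → Fin k => StrictMono g ∧ y ∘ g = z).card : ℝ)) =
      (Finset.univ.filter fun h : Fin l → Fin n => StrictMono h ∧ x ∘ h = z).card *
        (n - l).choose (k - l) by exact_mod_cast hcount]
  ring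

/-! #### Concatenation of outputs -/

/-- The concatenation of two output strings. -/
def concatOut {a b : ℕ} (y : DelOut a × DelOut b) : DelOut (a + b) :=
  ⟨⟨y.1.1 + y.2.1, by omega⟩, Fin.append y.1.2 y.2.2⟩

/-- The list of symbols of an output string. -/
def DelOut.toList (y : DelOut n) : List Bool := List.ofFn y.2

lemma DelOut.length_toList (y : DelOut n) : y.toList.length = y.1 := List.length_ofFn

lemma DelOut.toList_injective : Function.Injective (DelOut.toList (n := n)) := by
  rintro ⟨⟨k, hk⟩, y⟩ ⟨⟨l, hl⟩, z⟩ h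
  have h' := List.ofFn_inj'.1 h
  obtain rfl : k = l := congrArg Sigma.fst h'
  simpa using h'

lemma toList_concatOut {a b : ℕ} (y : DelOut a × DelOut b) :
    (concatOut y).toList = y.1.toList ++ y.2.toList :=
  List.ofFn_fin_append _ _

lemma toList_restrictSub (x : Fin n → Bool) (S : Finset (Fin n)) :
    (restrictSub x S).toList = S.sort.map x := by
  rw [DelOut.toList, restrictSub, ← Finset.listMap_orderEmbOfFin_finRange S rfl, List.map_map,
    List.ofFn_eq_map]
  rfl

/-- A subset of `Fin (a + b)` is a subset of `Fin a` together with a subset of `Fin b`. -/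
def finsetFinAddEquiv (a b : ℕ) : Finset (Fin a) × Finset (Fin b) ≃ Finset (Fin (a + b)) :=
  Finset.sumEquiv.symm.toEquiv.trans finSumFinEquiv.finsetCongr

lemma finsetFinAddEquiv_apply {a b : ℕ} (U : Finset (Fin a) × Finset (Fin b)) :
    finsetFinAddEquiv a b U = (U.1.disjSum U.2).map finSumFinEquiv.toEmbedding := rfl

lemma card_finsetFinAddEquiv {a b : ℕ} (U : Finset (Fin a) × Finset (Fin b)) :
    (finsetFinAddEquiv a b U).card = U.1.card + U.2.card := by
  rw [finsetFinAddEquiv_apply, Finset.card_map, Finset.card_disjSum]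

lemma sort_finsetFinAddEquiv {a b : ℕ} (U : Finset (Fin a) × Finset (Fin b)) :
    (finsetFinAddEquiv a b U).sort =
      U.1.sort.map (Fin.castAdd b) ++ U.2.sort.map (Fin.natAdd a) := by
  have hsorted : (U.1.sort.map (Fin.castAdd b) ++ U.2.sort.map (Fin.natAdd a)).Pairwise
      (· < ·) := by
    rw [List.pairwise_append]
    refine ⟨?_, ?_, ?_⟩
    · exact List.pairwise_map.2 (U.1.sortedLT_sort.pairwise.imp
        fun h => Fin.strictMono_castAdd b h)
    · exact List.pairwise_map.2 (U.2.sortedLT_sort.pairwise.imp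
        fun h => by simpa using h)
    · intro i hi j hj
      obtain ⟨i, -, rfl⟩ := List.mem_map.1 hi
      obtain ⟨j, -, rfl⟩ := List.mem_map.1 hj
      rw [Fin.lt_def, Fin.val_castAdd, Fin.val_natAdd]
      omega
  have hnodup : (U.1.sort.map (Fin.castAdd b) ++ U.2.sort.map (Fin.natAdd a)).Nodup :=
    hsorted.imp fun h => h.ne
  rw [← (List.toFinset_sort (r := (· ≤ ·)) hnodup).2 (hsorted.imp fun h => h.le)]
  congr 1
  ext i
  simp only [finsetFinAddEquiv_apply, Finset.mem_map, Finset.mem_disjSum, List.mem_toFinset,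
    List.mem_append, List.mem_map, Finset.mem_sort]
  constructor
  · rintro ⟨j, ⟨i, hi, rfl⟩ | ⟨i, hi, rfl⟩, rfl⟩
    · exact Or.inl ⟨i, hi, by simp⟩
    · exact Or.inr ⟨i, hi, by simp⟩
  · rintro (⟨i, hi, rfl⟩ | ⟨i, hi, rfl⟩)
    · exact ⟨_, Or.inl ⟨i, hi, rfl⟩, by simp⟩
    · exact ⟨_, Or.inr ⟨i, hi, rfl⟩, by simp⟩

lemma restrictSub_append {a b : ℕ} (x : Fin a → Bool) (x' : Fin b → Bool)
    (U : Finset (Fin a) × Finset (Fin b)) :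
    restrictSub (Fin.append x x') (finsetFinAddEquiv a b U) =
      concatOut (restrictSub x U.1, restrictSub x' U.2) := by
  apply DelOut.toList_injective
  rw [toList_restrictSub, toList_concatOut, toList_restrictSub, toList_restrictSub,
    sort_finsetFinAddEquiv, List.map_append, List.map_map, List.map_map]
  congr 2 <;> funext i <;> simp

/-- Deleting bits from a concatenation amounts to deleting bits from both parts independently and
concatenating the results. -/
lemma delW_append {a b : ℕ} (d : ℝ) :
    delW d ∘ Fin.appendEquiv a b =
      compChannel (prodChannel (delW (n := a) d) (delW (n := b) d)) (mapChannel concatOut) := by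
  funext ⟨x, x'⟩ z
  have hR : compChannel (prodChannel (delW (n := a) d) (delW (n := b) d)) (mapChannel concatOut)
      (x, x') z = ∑ U : Finset (Fin a) × Finset (Fin b),
        ((1 - d) ^ U.1.card * d ^ (a - U.1.card)) * ((1 - d) ^ U.2.card * d ^ (b - U.2.card)) *
          mapChannel concatOut (restrictSub x U.1, restrictSub x' U.2) z := by
    have hprod : ∀ y : DelOut a × DelOut b, prodChannel (delW d) (delW d) (x, x') y =
        ∑ U : Finset (Fin a) × Finset (Fin b),
          if (restrictSub x U.1, restrictSub x' U.2) = y then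
            ((1 - d) ^ U.1.card * d ^ (a - U.1.card)) * ((1 - d) ^ U.2.card * d ^ (b - U.2.card))
          else 0 := by
      rintro ⟨y₁, y₂⟩
      simp only [prodChannel, delW, Finset.sum_mul_sum, Fintype.sum_prod_type, Prod.mk.injEq,
        ite_and, ite_mul, mul_ite, zero_mul, mul_zero]
      refine Finset.sum_congr rfl fun S _ => Finset.sum_congr rfl fun T _ => ?_
      split_ifs <;> rfl
    simp only [compChannel, hprod, Finset.sum_mul]
    rw [Finset.sum_comm]
    refine Finset.sum_congr rfl fun U _ => ?_
    simp only [ite_mul, zero_mul, Finset.sum_ite_eq, Finset.mem_univ, if_true]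
  rw [hR, Function.comp_apply, delW, ← Equiv.sum_comp (finsetFinAddEquiv a b)]
  refine Finset.sum_congr rfl fun U _ => ?_
  have h₁ : U.1.card ≤ a := by simpa using Finset.card_le_univ U.1
  have h₂ : U.2.card ≤ b := by simpa using Finset.card_le_univ U.2
  have hsub : a + b - (U.1.card + U.2.card) = (a - U.1.card) + (b - U.2.card) := by omega
  rw [show Fin.appendEquiv a b (x, x') = Fin.append x x' from rfl, restrictSub_append,
    card_finsetFinAddEquiv, hsub, pow_add, pow_add, mapChannel, mul_ite, mul_one, mul_zero]
  refine if_congr Iff.rfl ?_ rfl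
  ring

lemma card_fiber_concatOut_le {a b : ℕ} (z : DelOut (a + b)) :
    (Finset.univ.filter fun y : DelOut a × DelOut b => concatOut y = z).card ≤ b + 1 := by
  refine (Finset.card_le_card_of_injOn (t := Finset.univ) (fun y => y.2.1)
    (fun _ _ => Finset.mem_coe.2 (Finset.mem_univ _)) ?_).trans_eq (Finset.card_fin (b + 1))
  rintro ⟨y₁, y₂⟩ hy ⟨y₁', y₂'⟩ hy' (h : y₂.1 = y₂'.1)
  simp only [Finset.coe_filter, Finset.mem_univ, true_and, Set.mem_ofPred_eq] at hy hy'
  have hl := congrArg DelOut.toList (hy.trans hy'.symm)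
  rw [toList_concatOut, toList_concatOut] at hl
  have hlen : y₂.toList.length = y₂'.toList.length := by
    rw [DelOut.length_toList, DelOut.length_toList, h]
  obtain ⟨e₁, e₂⟩ := List.append_inj' hl hlen
  exact Prod.ext (DelOut.toList_injective e₁) (DelOut.toList_injective e₂)

end Combinatorics

/-! ### Tails of the number of surviving bits -/

section Tails

open ProbabilityTheory MeasureTheory in
/-- Hoeffding's lemma for a Bernoulli variable. -/
lemma bernoulli_mgf_le {q : ℝ} (h0 : 0 ≤ q) (h1 : q ≤ 1) (t : ℝ) :
    q * Real.exp t + (1 - q) ≤ Real.exp (q * t + t ^ 2 / 8) := by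
  set μ : Measure ℝ := bernoulliMeasure 1 0 ⟨q, h0, h1⟩
  have hmem : ∀ᵐ x ∂μ, x ∈ Set.Icc (0 : ℝ) 1 := by
    rw [ae_iff]
    exact bernoulliMeasure_apply_of_notMem_of_notMem _ measurableSet_Icc.compl
      (by simp) (by simp)
  have h := (hasSubgaussianMGF_of_mem_Icc (X := id) aemeasurable_id hmem).mgf_le t
  simp only [mgf, μ, integral_bernoulliMeasure, id, smul_eq_mul, mul_one, mul_zero, add_zero]
    at h
  norm_num at h
  have hmul := mul_le_mul_of_nonneg_right h (Real.exp_pos (q * t)).le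
  rw [← Real.exp_add, add_mul, mul_assoc, mul_assoc, ← Real.exp_add, ← Real.exp_add] at hmul
  ring_nf at hmul ⊢
  rw [Real.exp_zero] at hmul
  linarith

/-- The probability that exactly `l` of `n` bits survive. -/
def survivalProb (n : ℕ) (d : ℝ) (l : ℕ) : ℝ := (1 - d) ^ l * d ^ (n - l) * n.choose l

variable {n : ℕ} {d : ℝ}

lemma survivalProb_nonneg (h0 : 0 ≤ d) (h1 : d ≤ 1) (l : ℕ) : 0 ≤ survivalProb n d l := by
  have : 0 ≤ 1 - d := by linarith
  unfold survivalProb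
  positivity

lemma sum_survivalProb_mul_pow (n : ℕ) (d a : ℝ) :
    ∑ l : Fin (n + 1), survivalProb n d l * a ^ (l : ℕ) = ((1 - d) * a + d) ^ n := by
  rw [add_pow, ← Fin.sum_univ_eq_sum_range
    (fun l => ((1 - d) * a) ^ l * d ^ (n - l) * (n.choose l : ℝ))]
  refine Finset.sum_congr rfl fun l _ => ?_
  rw [survivalProb, mul_pow]
  ring

lemma sum_survivalProb (n : ℕ) (d : ℝ) : ∑ l : Fin (n + 1), survivalProb n d l = 1 := by
  simpa using sum_survivalProb_mul_pow n d 1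

/-- The Chernoff–Hoeffding bound for the number of surviving bits. -/
lemma sum_survivalProb_ite_le (h0 : 0 ≤ d) (h1 : d ≤ 1) (t u : ℝ) (P : ℕ → Prop)
    [DecidablePred P] (hP : ∀ l, P l → u ≤ t * (l - n * (1 - d))) :
    (∑ l : Fin (n + 1), if P l then survivalProb n d l else 0) ≤
      Real.exp (n * t ^ 2 / 8 - u) := by
  calc (∑ l : Fin (n + 1), if P l then survivalProb n d l else 0)
      ≤ ∑ l : Fin (n + 1), survivalProb n d l * Real.exp t ^ (l : ℕ) *
          Real.exp (-(t * (n * (1 - d))) - u) := by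
        refine Finset.sum_le_sum fun l _ => ?_
        have hB := survivalProb_nonneg (n := n) h0 h1 l
        split_ifs with hl
        · rw [mul_assoc, ← Real.exp_nat_mul, ← Real.exp_add]
          refine le_mul_of_one_le_right hB (Real.one_le_exp ?_)
          have := hP l hl
          linarith
        · positivity
    _ = ((1 - d) * Real.exp t + d) ^ n * Real.exp (-(t * (n * (1 - d))) - u) := by
        rw [← Finset.sum_mul, sum_survivalProb_mul_pow]
    _ ≤ Real.exp ((1 - d) * t + t ^ 2 / 8) ^ n * Real.exp (-(t * (n * (1 - d))) - u) := by
        have h := bernoulli_mgf_le (q := 1 - d) (by linarith) (by linarith) t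
        rw [sub_sub_cancel] at h
        have hnn : 0 ≤ (1 - d) * Real.exp t + d :=
          add_nonneg (mul_nonneg (by linarith) (Real.exp_pos t).le) h0
        gcongr
    _ = Real.exp (n * t ^ 2 / 8 - u) := by
        rw [← Real.exp_nat_mul, ← Real.exp_add]
        congr 1
        ring

end Tails

/-! ### Comparison of the capacities -/

section Capacity

variable {n k l : ℕ} {d : ℝ}

instance nonempty_isDist (n : ℕ) : Nonempty {p : (Fin n → Bool) → ℝ // IsDist p} :=
  ⟨⟨mapChannel id fun _ => false, isDist_mapChannel _ _⟩⟩

lemma mutualInfo_le_length {β : Type*} [Fintype β] {p : (Fin n → Bool) → ℝ}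
    {W : (Fin n → Bool) → β → ℝ} (hp : IsDist p) (hW : ∀ x, IsDist (W x)) :
    mutualInfo p W ≤ n := by
  refine (mutualInfo_le_logb_card hp hW).trans_eq ?_
  simp [Real.logb_pow]

lemma bddAbove_mutualInfo {β : Type*} [Fintype β] {W : (Fin n → Bool) → β → ℝ}
    (hW : ∀ x, IsDist (W x)) :
    BddAbove (Set.range fun p : {p : (Fin n → Bool) → ℝ // IsDist p} => mutualInfo p.1 W) :=
  ⟨n, by rintro _ ⟨p, rfl⟩; exact mutualInfo_le_length p.2 hW⟩

/-- The unnormalized capacity `n · C_n(d)`. -/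
def delCap (d : ℝ) (n : ℕ) : ℝ :=
  ⨆ p : {p : (Fin n → Bool) → ℝ // IsDist p}, mutualInfo p.1 (delW d)

lemma Cn_eq (n : ℕ) (d : ℝ) : Cn n d = delCap d n / n := by
  rw [Cn, delCap, one_div, inv_mul_eq_div]

lemma mutualInfo_le_delCap (h0 : 0 ≤ d) (h1 : d ≤ 1) {p : (Fin n → Bool) → ℝ} (hp : IsDist p) :
    mutualInfo p (delW d) ≤ delCap d n :=
  le_ciSup (bddAbove_mutualInfo (isDist_delW h0 h1)) (⟨p, hp⟩ : {p // IsDist p})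

lemma delCap_nonneg (h0 : 0 ≤ d) (h1 : d ≤ 1) (n : ℕ) : 0 ≤ delCap d n :=
  Real.iSup_nonneg fun p => mutualInfo_nonneg p.2 (isDist_delW h0 h1)

lemma delCap_zero_le (h0 : 0 ≤ d) (h1 : d ≤ 1) : delCap d 0 ≤ 0 :=
  ciSup_le fun p => (mutualInfo_le_length p.2 (isDist_delW h0 h1)).trans_eq Nat.cast_zero

lemma delCap_add_le (h0 : 0 ≤ d) (h1 : d ≤ 1) (a b : ℕ) :
    delCap d (a + b) ≤ delCap d a + delCap d b := by
  refine ciSup_le fun p => ?_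
  have hp := p.2.comp_equiv (Fin.appendEquiv a b)
  rw [← mutualInfo_comp_equiv (Fin.appendEquiv a b), delW_append]
  calc _ ≤ _ := mutualInfo_compChannel_le hp
        (isDist_prodChannel (isDist_delW h0 h1) (isDist_delW h0 h1)) (isDist_mapChannel _)
    _ ≤ _ := mutualInfo_prodChannel_le hp (isDist_delW h0 h1) (isDist_delW h0 h1)
    _ ≤ _ := add_le_add (mutualInfo_le_delCap h0 h1 (isDist_marginal_fst hp))
        (mutualInfo_le_delCap h0 h1 (isDist_marginal_snd hp))

lemma le_delCap_add (h0 : 0 ≤ d) (h1 : d ≤ 1) (a b : ℕ) :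
    delCap d a + delCap d b - Real.logb 2 (b + 1) ≤ delCap d (a + b) := by
  have key : ∀ (p₁ : {p : (Fin a → Bool) → ℝ // IsDist p})
      (p₂ : {p : (Fin b → Bool) → ℝ // IsDist p}),
      mutualInfo p₁.1 (delW d) + mutualInfo p₂.1 (delW d) ≤
        delCap d (a + b) + Real.logb 2 (b + 1) := by
    intro p₁ p₂
    have hp := p₁.2.prod p₂.2
    rw [← mutualInfo_prodChannel_of_indep p₁.2 p₂.2 (isDist_delW h0 h1) (isDist_delW h0 h1)]
    refine (mutualInfo_le_compChannel_mapChannel_add hp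
      (isDist_prodChannel (isDist_delW h0 h1) (isDist_delW h0 h1)) concatOut (b + 1)
      card_fiber_concatOut_le).trans ?_
    rw [← delW_append]
    push_cast
    refine add_le_add_left ?_ _
    rw [← mutualInfo_comp_equiv (Fin.appendEquiv a b).symm, Function.comp_assoc,
      Equiv.self_comp_symm, Function.comp_id]
    exact mutualInfo_le_delCap h0 h1 (hp.comp_equiv _)
  have h₁ : delCap d a ≤ delCap d (a + b) + Real.logb 2 (b + 1) - delCap d b := by
    refine ciSup_le fun p₁ => ?_
    have h₂ : delCap d b ≤ delCap d (a + b) + Real.logb 2 (b + 1) - mutualInfo p₁.1 (delW d) :=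
      ciSup_le fun p₂ => by linarith [key p₁ p₂]
    linarith
  linarith

lemma delCap_mul_le (h0 : 0 ≤ d) (h1 : d ≤ 1) (j m : ℕ) :
    delCap d (j * m) ≤ j * delCap d m := by
  induction j with
  | zero => simpa using delCap_zero_le h0 h1
  | succ j ih =>
    rw [Nat.succ_mul]
    have := delCap_add_le h0 h1 (j * m) m
    push_cast
    linarith

lemma le_delCap_mul (h0 : 0 ≤ d) (h1 : d ≤ 1) (j m : ℕ) :
    j * (delCap d m - Real.logb 2 (m + 1)) ≤ delCap d (j * m) := by
  induction j with
  | zero => simpa using delCap_nonneg h0 h1 0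
  | succ j ih =>
    rw [Nat.succ_mul]
    have := le_delCap_add h0 h1 (j * m) m
    push_cast
    linarith

lemma Cn_nonneg (h0 : 0 ≤ d) (h1 : d ≤ 1) (n : ℕ) : 0 ≤ Cn n d := by
  rw [Cn_eq]
  exact div_nonneg (delCap_nonneg h0 h1 n) n.cast_nonneg

lemma C_le_Cn (h0 : 0 ≤ d) (h1 : d ≤ 1) (hn : 1 ≤ n) : C d ≤ Cn n d :=
  ciInf_le ⟨0, by rintro _ ⟨m, rfl⟩; exact Cn_nonneg h0 h1 m⟩ (⟨n, hn⟩ : {m : ℕ // 1 ≤ m})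

lemma Cn_le_C_add (h0 : 0 ≤ d) (h1 : d ≤ 1) (hn : 1 ≤ n) :
    Cn n d ≤ C d + Real.logb 2 (n + 1) / n := by
  rw [← sub_le_iff_le_add]
  have : Nonempty {m : ℕ // 1 ≤ m} := ⟨⟨1, le_rfl⟩⟩
  refine le_ciInf fun ⟨m, hm⟩ => ?_
  have hn' : (0 : ℝ) < n := by exact_mod_cast hn
  have hm' : (0 : ℝ) < m := by exact_mod_cast hm
  have h := (le_delCap_mul h0 h1 m n).trans
    ((congrArg (delCap d) (mul_comm m n)).trans_le (delCap_mul_le h0 h1 n m))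
  rw [Cn_eq, Cn_eq, ← sub_div, div_le_div_iff₀ hn' hm']
  linarith

lemma mutualInfo_delW (p : (Fin n → Bool) → ℝ) (d : ℝ) :
    mutualInfo p (delW d) =
      ∑ l : Fin (n + 1), survivalProb n d l * mutualInfo p (exactW (k := l)) := by
  simp only [mutualInfo, Fintype.sum_sigma, Finset.mul_sum]
  rw [Finset.sum_comm]
  refine Finset.sum_congr rfl fun l _ => Finset.sum_congr rfl fun x _ =>
    Finset.sum_congr rfl fun y _ => ?_
  have hW : ∀ x, delW d x ⟨l, y⟩ = survivalProb n d l * exactW x y := fun x =>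
    delW_eq_mul_exactW d x l y
  simp only [hW, mul_left_comm (p _), ← Finset.mul_sum]
  by_cases h : survivalProb n d l = 0
  · simp [h]
  · rw [mul_div_mul_left _ _ h]
    ring

lemma mutualInfo_exactW_mono (hlk : l ≤ k) (hkn : k ≤ n) {p : (Fin n → Bool) → ℝ}
    (hp : IsDist p) : mutualInfo p (exactW (k := l)) ≤ mutualInfo p (exactW (k := k)) := by
  rw [← compChannel_exactW hlk hkn]
  exact mutualInfo_compChannel_le hp (isDist_exactW hkn) (isDist_exactW hlk)

/-- The deletion channel exceeds the exact deletion channel by at most `n` times the probability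
that more than `k` bits survive. -/
lemma mutualInfo_delW_le (h0 : 0 ≤ d) (h1 : d ≤ 1) (hkn : k ≤ n) {p : (Fin n → Bool) → ℝ}
    (hp : IsDist p) :
    mutualInfo p (delW d) ≤ mutualInfo p (exactW (k := k)) +
      (∑ l : Fin (n + 1), if k < (l : ℕ) then survivalProb n d l else 0) * n := by
  rw [mutualInfo_delW, Finset.sum_mul]
  conv_rhs => rw [← one_mul (mutualInfo p _), ← sum_survivalProb n d, Finset.sum_mul]
  rw [← Finset.sum_add_distrib]
  refine Finset.sum_le_sum fun l _ => ?_
  have hB := survivalProb_nonneg (n := n) h0 h1 l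
  have hln : (l : ℕ) ≤ n := Nat.lt_succ_iff.1 l.2
  split_ifs with hl
  · have hnn := mul_nonneg hB (mutualInfo_nonneg hp (isDist_exactW hkn))
    have hle := mul_le_mul_of_nonneg_left (mutualInfo_le_length hp (isDist_exactW hln)) hB
    linarith
  · rw [zero_mul, add_zero]
    exact mul_le_mul_of_nonneg_left (mutualInfo_exactW_mono (not_lt.1 hl) hkn hp) hB

/-- The exact deletion channel exceeds the deletion channel by at most `n` times the probability
that fewer than `k` bits survive. -/
lemma mutualInfo_exactW_le (h0 : 0 ≤ d) (h1 : d ≤ 1) (hkn : k ≤ n) {p : (Fin n → Bool) → ℝ}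
    (hp : IsDist p) :
    mutualInfo p (exactW (k := k)) ≤ mutualInfo p (delW d) +
      (∑ l : Fin (n + 1), if (l : ℕ) < k then survivalProb n d l else 0) * n := by
  rw [mutualInfo_delW, Finset.sum_mul]
  conv_lhs => rw [← one_mul (mutualInfo p _), ← sum_survivalProb n d, Finset.sum_mul]
  rw [← Finset.sum_add_distrib]
  refine Finset.sum_le_sum fun l _ => ?_
  have hB := survivalProb_nonneg (n := n) h0 h1 l
  have hln : (l : ℕ) ≤ n := Nat.lt_succ_iff.1 l.2
  split_ifs with hl
  · have hnn := mul_nonneg hB (mutualInfo_nonneg hp (isDist_exactW hln))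
    have hle := mul_le_mul_of_nonneg_left (mutualInfo_le_length hp (isDist_exactW hkn)) hB
    linarith
  · rw [zero_mul, add_zero]
    exact mul_le_mul_of_nonneg_left (mutualInfo_exactW_mono (not_lt.1 hl) hln hp) hB

lemma Cn_le_Cnk_add (h0 : 0 ≤ d) (h1 : d ≤ 1) (hn : 1 ≤ n) (hkn : k ≤ n) {δ : ℝ}
    (hδ : (∑ l : Fin (n + 1), if k < (l : ℕ) then survivalProb n d l else 0) ≤ δ) :
    Cn n d ≤ Cnk n k + δ := by
  have hn' : (0 : ℝ) < n := by exact_mod_cast hn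
  rw [Cn, Cnk, one_div, inv_mul_eq_div, inv_mul_eq_div, div_add' _ _ _ hn'.ne']
  gcongr
  refine ciSup_le fun p => (mutualInfo_delW_le h0 h1 hkn p.2).trans ?_
  gcongr
  exact le_ciSup (bddAbove_mutualInfo (isDist_exactW hkn)) p

lemma Cnk_le_Cn_add (h0 : 0 ≤ d) (h1 : d ≤ 1) (hn : 1 ≤ n) (hkn : k ≤ n) {δ : ℝ}
    (hδ : (∑ l : Fin (n + 1), if (l : ℕ) < k then survivalProb n d l else 0) ≤ δ) :
    Cnk n k ≤ Cn n d + δ := by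
  have hn' : (0 : ℝ) < n := by exact_mod_cast hn
  rw [Cn, Cnk, one_div, inv_mul_eq_div, inv_mul_eq_div, div_add' _ _ _ hn'.ne']
  gcongr
  refine ciSup_le fun p => (mutualInfo_exactW_le h0 h1 hkn p.2).trans ?_
  gcongr
  exact le_ciSup (bddAbove_mutualInfo (isDist_delW h0 h1)) p

end Capacity

/-- For every `ε > 0` and integers `1 ≤ k ≤ n` with `2ε ≤ k/n` and
`2ε ≤ 1 − k/n`, one has
`C(1 − k/n + ε) − 2e^{−2ε²n} ≤ C_{n,k} ≤ C(1 − k/n − ε) + 2e^{−2ε²n} + log₂(n+1)/n`. -/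
theorem Cnk_between_C (ε : ℝ) (hε : 0 < ε) (n k : ℕ) (hk1 : 1 ≤ k) (hkn : k ≤ n)
    (h1 : 2 * ε ≤ (k : ℝ) / n) (h2 : 2 * ε ≤ 1 - (k : ℝ) / n) :
    C (1 - (k : ℝ) / n + ε) - 2 * Real.exp (-2 * ε ^ 2 * n) ≤ Cnk n k ∧
    Cnk n k ≤ C (1 - (k : ℝ) / n - ε) + 2 * Real.exp (-2 * ε ^ 2 * n) +
      Real.logb 2 (n + 1) / n := by
  have hn : 1 ≤ n := hk1.trans hkn
  have hn' : (0 : ℝ) < n := by exact_mod_cast hn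
  have hkdiv : (n : ℝ) * (k / n) = k := mul_div_cancel₀ _ hn'.ne'
  have hexp : (n : ℝ) * (4 * ε) ^ 2 / 8 - 4 * ε ^ 2 * n = -2 * ε ^ 2 * n := by ring
  have hexp' : (n : ℝ) * (-4 * ε) ^ 2 / 8 - 4 * ε ^ 2 * n = -2 * ε ^ 2 * n := by ring
  have hpos := Real.exp_pos (-2 * ε ^ 2 * n)
  constructor
  · have h0 : 0 ≤ 1 - (k : ℝ) / n + ε := by linarith
    have h1' : 1 - (k : ℝ) / n + ε ≤ 1 := by linarith
    have htail := sum_survivalProb_ite_le (n := n) h0 h1' (4 * ε) (4 * ε ^ 2 * n)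
      (fun l => k < l) fun l hl => by
        have hkl : (0 : ℝ) ≤ l - k := sub_nonneg.2 (by exact_mod_cast hl.le)
        have := mul_nonneg hε.le hkl
        linear_combination 4 * this + 4 * ε * hkdiv
    rw [hexp] at htail
    linarith [C_le_Cn h0 h1' hn, Cn_le_Cnk_add h0 h1' hn hkn htail]
  · have h0 : 0 ≤ 1 - (k : ℝ) / n - ε := by linarith
    have h1' : 1 - (k : ℝ) / n - ε ≤ 1 := by linarith
    have htail := sum_survivalProb_ite_le (n := n) h0 h1' (-4 * ε) (4 * ε ^ 2 * n)
      (fun l => l < k) fun l hl => by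
        have hkl : (0 : ℝ) ≤ k - l := sub_nonneg.2 (by exact_mod_cast hl.le)
        have := mul_nonneg hε.le hkl
        linear_combination 4 * this - 4 * ε * hkdiv
    rw [hexp'] at htail
    linarith [Cn_le_C_add h0 h1' hn, Cnk_le_Cn_add h0 h1' hn hkn htail]
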